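/- Let p be a prime. The rank over the field with p elements of the oppositeness matrix of generators of the Hermitian polar space H(5, p^2) equals (11p^5 + 5p^3 + 4p)/20. -/

import Mathlib

section Auxiliary

open Finset

/-- The rank of a square matrix is unchanged by an extension of the base field. -/
theorem Matrix.rank_map_of_fieldHom {K L n : Type*} [Field K] [Field L] [Fintype n]
    (f : K →+* L) (M : Matrix n n K) : (M.map f).rank = M.rank := by
  classical
  obtain ⟨V, U, e, hV, hU, h⟩ := M.exists_rank_normal_form
  have key : ∀ (E : Type _) [Field E], ((fromBlocks 1 0 0 0 :
      Matrix (Fin M.rank ⊕ Fin (Fintype.card n - M.rank)) _ E).submatrix e e).rank = M.rank := by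
    intro E _
    rw [rank_submatrix, ← diagonal_one, ← diagonal_zero, fromBlocks_diagonal, rank_diagonal,
      Fintype.card_subtype]
    have : (univ.filter fun x : Fin M.rank ⊕ Fin (Fintype.card n - M.rank) =>
        Sum.elim (fun _ => (1 : E)) (fun _ => 0) x ≠ 0) = univ.map Function.Embedding.inl := by
      ext (i | i) <;> simp
    exact (congrArg Finset.card this).trans (by simp)
  have hV' : IsUnit (V.map f).det := by
    rw [← f.mapMatrix_apply, ← f.map_det]
    exact ((isUnit_iff_isUnit_det _).1 hV).map f
  have hU' : IsUnit (U.map f).det := by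
    rw [← f.mapMatrix_apply, ← f.map_det]
    exact ((isUnit_iff_isUnit_det _).1 hU).map f
  have h' := congrArg (fun N => N.map f) h
  simp only [Matrix.map_mul] at h'
  rw [← rank_mul_eq_right_of_isUnit_det _ (M.map f) hV',
    ← rank_mul_eq_left_of_isUnit_det _ (V.map f * M.map f) hU', h',
    ← submatrix_map, fromBlocks_map]
  simpa using key L

/-- A product of a matrix with independent columns and a matrix with independent rows has rank
equal to the number of inner indices. -/
theorem Matrix.rank_mul_eq_card_of_linearIndependent {K m ι n : Type*} [Field K] [Fintype m]
    [Fintype ι] [Fintype n] (A : Matrix m ι K) (B : Matrix ι n K)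
    (hA : LinearIndependent K A.col) (hB : LinearIndependent K B.row) :
    (A * B).rank = Fintype.card ι := by
  have h1 : Function.Injective A.mulVecLin := Matrix.mulVec_injective_iff.2 hA
  have h2 : LinearMap.range B.mulVecLin = ⊤ := by
    apply Submodule.eq_top_of_finrank_eq
    rw [Module.finrank_fintype_fun_eq_card]
    exact hB.rank_matrix
  rw [Matrix.rank, Matrix.mulVecLin_mul, LinearMap.range_comp_of_range_eq_top _ h2,
    LinearMap.finrank_range_of_inj h1, Module.finrank_fintype_fun_eq_card]

/-- The exponents of the monomials of degree `3 (p - 1)` in six variables whose exponents are all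
less than `p`. -/
def truncatedExponents (p : ℕ) : Finset (Fin 3 ⊕ Fin 3 →₀ ℕ) :=
  ((univ : Finset (Fin 3 ⊕ Fin 3)).finsuppAntidiag (3 * (p - 1))).filter (∀ s, · s < p)

theorem mem_truncatedExponents {p : ℕ} {β : Fin 3 ⊕ Fin 3 →₀ ℕ} :
    β ∈ truncatedExponents p ↔ ∑ s, β s = 3 * (p - 1) ∧ ∀ s, β s < p := by
  simp [truncatedExponents, Finset.mem_finsuppAntidiag]

theorem card_truncatedExponents {p : ℕ} (hp : 2 ≤ p) :
    20 * #(truncatedExponents p) = 11 * p ^ 5 + 5 * p ^ 3 + 4 * p := by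
  have h1 : (#(truncatedExponents p) : ℤ) = PowerSeries.coeff (3 * (p - 1))
      ((∑ i ∈ range p, (PowerSeries.X : PowerSeries ℤ) ^ i) ^ 6) := by
    have : ((∑ i ∈ range p, (PowerSeries.X : PowerSeries ℤ) ^ i) ^ 6) =
        ∏ _s : Fin 3 ⊕ Fin 3, ∑ i ∈ range p, (PowerSeries.X : PowerSeries ℤ) ^ i := by
      simp
    rw [this, PowerSeries.coeff_prod, truncatedExponents, Finset.card_filter, Nat.cast_sum]
    refine Finset.sum_congr rfl fun l _ => ?_
    simp only [map_sum, PowerSeries.coeff_X_pow, Finset.sum_ite_eq, Finset.mem_range]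
    rw [Finset.prod_ite_zero]
    simp
  have h2 : (∑ i ∈ range p, (PowerSeries.X : PowerSeries ℤ) ^ i) ^ 6 =
      (1 - PowerSeries.X ^ p) ^ 6 * (PowerSeries.mk fun n => (Nat.choose (5 + n) 5 : ℤ)) := by
    have h := PowerSeries.mk_add_choose_mul_one_sub_pow_eq_one ℤ 5
    rw [← geom_sum_mul_neg, mul_pow, mul_assoc, mul_comm ((1 - PowerSeries.X) ^ 6), h, mul_one]
  have h3 : (1 - (PowerSeries.X : PowerSeries ℤ) ^ p) ^ 6 =
      1 - PowerSeries.C 6 * PowerSeries.X ^ p + PowerSeries.C 15 * PowerSeries.X ^ (2 * p)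
        - PowerSeries.X ^ (3 * p) * (PowerSeries.C 20 - PowerSeries.C 15 * PowerSeries.X ^ p
          + PowerSeries.C 6 * PowerSeries.X ^ (2 * p) - PowerSeries.X ^ (3 * p)) := by
    simp only [map_ofNat]
    ring
  rw [h2, h3] at h1
  obtain ⟨q, rfl⟩ := Nat.exists_eq_add_of_le' hp
  simp only [sub_mul, add_mul, mul_assoc, one_mul, map_sub, map_add, PowerSeries.coeff_C_mul,
    PowerSeries.coeff_X_pow_mul', PowerSeries.coeff_mk] at h1
  have e1 : 5 + 3 * (q + 2 - 1) = 3 * q + 8 := by omega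
  have e2 : 5 + (3 * (q + 2 - 1) - (q + 2)) = 2 * q + 6 := by omega
  have e3 : (if 2 * (q + 2) ≤ 3 * (q + 2 - 1) then
      ((5 + (3 * (q + 2 - 1) - 2 * (q + 2))).choose 5 : ℤ) else 0) = (q + 4).choose 5 := by
    split_ifs with h
    · congr 2
      omega
    · obtain rfl : q = 0 := by omega
      simp [Nat.choose]
  rw [if_pos (by omega), if_neg (by omega : ¬ 3 * (q + 2) ≤ 3 * (q + 2 - 1)), e1, e2, e3] at h1
  have c : ∀ n : ℕ, (120 : ℤ) * ((n + 4).choose 5 : ℕ) =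
      (n + 4) * (n + 3) * (n + 2) * (n + 1) * n := by
    intro n
    have := Nat.descFactorial_eq_factorial_mul_choose (n + 4) 5
    simp [Nat.descFactorial, Nat.factorial] at this
    have := congrArg (Nat.cast : ℕ → ℤ) this
    push_cast at this
    linarith
  have c1 := c (3 * q + 4)
  have c2 := c (2 * q + 2)
  have c3 := c q
  push_cast at c1 c2 c3
  zify
  have : (120 : ℤ) * #(truncatedExponents (q + 2)) =
    6 * (11 * (q + 2) ^ 5 + 5 * (q + 2) ^ 3 + 4 * (q + 2)) := by
    rw [h1]
    linear_combination c1 - 6 * c2 + 15 * c3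
  linarith

/-- If every linear combination `z` of the `y j` satisfies `z ^ (k + 1) = 0`, then the product of
the `k`-th powers of `n` such combinations is governed by the determinant. -/
theorem prod_sum_smul_pow_eq_det_pow_smul {K T n : Type*} [Field K] [CommRing T] [Algebra K T]
    [Fintype n] [DecidableEq n] (k : ℕ) (A : Matrix n n K) (y : n → T)
    (hy : ∀ c : n → K, (∑ j, c j • y j) ^ (k + 1) = 0) :
    ∏ i, (∑ j, A i j • y j) ^ k = A.det ^ k • ∏ i, y i ^ k := by
  induction A using Matrix.diagonal_transvection_induction generalizing y with
  | hdiag D _ =>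
    simp [Matrix.diagonal_apply, ite_smul, _root_.smul_pow, Finset.prod_smul, Finset.prod_pow]
  | htransvec t =>
    obtain ⟨i, j, hij, c⟩ := t
    simp only [Matrix.TransvectionStruct.toMatrix_mk, Matrix.det_transvection_of_ne i j hij,
      one_pow, one_smul]
    have hrow : ∀ r, ∑ s, Matrix.transvection i j c r s • y s =
        y r + if r = i then c • y j else 0 := by
      intro r
      simp only [Matrix.transvection, Matrix.add_apply, Matrix.one_apply, Matrix.single_apply,
        add_smul, ite_smul, one_smul, zero_smul, Finset.sum_add_distrib, Finset.sum_ite_eq,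
        Finset.mem_univ, if_true, ite_and]
      simp [eq_comm]
    simp only [hrow]
    have hj : y j ^ (k + 1) = 0 := by simpa [Pi.single_apply] using hy (Pi.single j 1)
    have hi' : j ∈ univ.erase i := by simp [hij.symm]
    rw [← Finset.mul_prod_erase _ _ (mem_univ i), ← Finset.mul_prod_erase _ _ (mem_univ i),
      ← Finset.mul_prod_erase _ _ hi', ← Finset.mul_prod_erase _ _ hi', if_pos rfl,
      if_neg hij.symm, add_zero, ← mul_assoc, ← mul_assoc]
    congr 1
    · obtain ⟨w, hw⟩ := sub_dvd_pow_sub_pow (y i + c • y j) (y i) k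
      rw [eq_comm, ← sub_eq_zero, ← sub_mul, ← neg_sub, hw, add_sub_cancel_left, neg_mul]
      rw [show c • y j * w * y j ^ k = (c • w) * y j ^ (k + 1) by
        rw [pow_succ, smul_mul_assoc, smul_mul_assoc, smul_mul_assoc]; ring_nf, hj, mul_zero,
        neg_zero]
    · refine Finset.prod_congr rfl fun r hr => ?_
      simp only [Finset.mem_erase] at hr
      rw [if_neg hr.2.1, add_zero]
  | hmul A B hA hB =>
    have hcomb : ∀ c : n → K, ∑ j, c j • ∑ l, B j l • y l =
        ∑ l, (∑ j, c j * B j l) • y l := by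
      intro c
      simp only [Finset.smul_sum, Finset.sum_smul, smul_smul]
      exact Finset.sum_comm
    have h := hA (fun j => ∑ l, B j l • y l) fun c => by rw [hcomb]; exact hy _
    simp only [hcomb] at h
    simp only [Matrix.mul_apply, h, hB y hy, Matrix.det_mul, mul_pow, smul_smul]

/-- The ideal generated by the `p`-th powers of the variables. -/
noncomputable def truncationIdeal (K σ : Type*) [Field K] (p : ℕ) : Ideal (MvPolynomial σ K) :=
  Ideal.span ((fun s => MvPolynomial.monomial s 1) '' Set.range fun s => Finsupp.single s p)

theorem coeff_eq_of_mk_eq {K σ : Type*} [Field K] {p : ℕ} {f g : MvPolynomial σ K}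
    {β : σ →₀ ℕ} (hβ : ∀ s, β s < p)
    (h : Ideal.Quotient.mk (truncationIdeal K σ p) f = Ideal.Quotient.mk _ g) :
    f.coeff β = g.coeff β := by
  rw [Ideal.Quotient.eq, truncationIdeal, MvPolynomial.mem_ideal_span_monomial_image] at h
  by_contra hne
  obtain ⟨_, ⟨s, rfl⟩, hs⟩ := h β (by
    rw [MvPolynomial.mem_support_iff, MvPolynomial.coeff_sub]
    exact sub_ne_zero.2 hne)
  have := hs s
  simp only [Finsupp.single_eq_same] at this
  exact absurd (hβ s) (by omega)

section Truncated

variable {K σ : Type*} [Field K] [Fintype σ]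

/-- The linear form with the given coefficients. -/
noncomputable def linearForm (r : σ → K) : MvPolynomial σ K :=
  ∑ s, r s • MvPolynomial.X s

/-- The product of the `k`-th powers of the linear forms given by the rows of a matrix. -/
noncomputable def rowPowProd {m : Type*} [Fintype m] (k : ℕ) (R : Matrix m σ K) :
    MvPolynomial σ K :=
  ∏ i, linearForm (R i) ^ k

theorem mk_linearForm_pow {p : ℕ} [Fact p.Prime] [CharP K p] (r : σ → K) :
    Ideal.Quotient.mk (truncationIdeal K σ p) (linearForm r) ^ p = 0 := by
  rw [← map_pow, Ideal.Quotient.eq_zero_iff_mem, linearForm, sum_pow_char]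
  refine Ideal.sum_mem _ fun s _ => ?_
  rw [smul_pow, MvPolynomial.smul_eq_C_mul]
  refine Ideal.mul_mem_left _ _ (Ideal.subset_span ⟨_, ⟨s, rfl⟩, ?_⟩)
  simp [MvPolynomial.X_pow_eq_monomial]

theorem mk_rowPowProd_mul {m : Type*} [Fintype m] [DecidableEq m] {p : ℕ} [Fact p.Prime]
    [CharP K p] (C : Matrix m m K) (R : Matrix m σ K) :
    Ideal.Quotient.mk (truncationIdeal K σ p) (rowPowProd (p - 1) (C * R)) =
      Ideal.Quotient.mk _ (C.det ^ (p - 1) • rowPowProd (p - 1) R) := by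
  have hp : p - 1 + 1 = p := Nat.sub_add_cancel (Fact.out : p.Prime).one_le
  have hlin : ∀ c : m → K, ∑ j, c j • linearForm (R j) = linearForm (Matrix.vecMul c R) := by
    intro c
    simp only [linearForm, Finset.smul_sum, smul_smul, Matrix.vecMul, dotProduct,
      Finset.sum_smul]
    exact Finset.sum_comm
  have h := prod_sum_smul_pow_eq_det_pow_smul (p - 1) C
    (fun j => Ideal.Quotient.mkₐ K (truncationIdeal K σ p) (linearForm (R j))) (fun c => by
      simp only [← map_smul, ← map_sum, hlin, hp]
      exact mk_linearForm_pow _)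
  simp only [← map_smul, ← map_sum, hlin, ← map_pow, ← map_prod] at h
  exact h

theorem coeff_rowPowProd_mul {m : Type*} [Fintype m] [DecidableEq m] {p : ℕ} [Fact p.Prime]
    [CharP K p] (C : Matrix m m K) (R : Matrix m σ K) {β : σ →₀ ℕ} (hβ : ∀ s, β s < p) :
    (rowPowProd (p - 1) (C * R)).coeff β =
      C.det ^ (p - 1) * (rowPowProd (p - 1) R).coeff β := by
  rw [coeff_eq_of_mk_eq hβ (mk_rowPowProd_mul C R), MvPolynomial.coeff_smul, smul_eq_mul]

theorem coeff_rowPowProd_square [DecidableEq σ] {p : ℕ} [Fact p.Prime] [CharP K p]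
    (P : Matrix σ σ K) :
    (rowPowProd (p - 1) P).coeff (Finsupp.equivFunOnFinite.symm fun _ => p - 1) =
      P.det ^ (p - 1) := by
  have hp : 0 < p := (Fact.out : p.Prime).pos
  rw [← mul_one P, coeff_rowPowProd_mul _ _ (fun s => by simpa using hp), mul_one]
  have : rowPowProd (p - 1) (1 : Matrix σ σ K) =
      MvPolynomial.monomial (Finsupp.equivFunOnFinite.symm fun _ => p - 1) 1 := by
    rw [MvPolynomial.monomial_eq, Finsupp.prod_fintype _ _ (by simp)]
    simp [rowPowProd, linearForm, Matrix.one_apply, ite_smul]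
  rw [this, MvPolynomial.coeff_monomial, if_pos rfl, mul_one]

theorem rowPowProd_fromRows {m m' : Type*} [Fintype m] [Fintype m'] (k : ℕ) (R : Matrix m σ K)
    (R' : Matrix m' σ K) :
    rowPowProd k (Matrix.fromRows R R') = rowPowProd k R * rowPowProd k R' := by
  simp [rowPowProd, Fintype.prod_sum_type]
  rfl

theorem isHomogeneous_rowPowProd {m : Type*} [Fintype m] (k : ℕ) (R : Matrix m σ K) :
    (rowPowProd k R).IsHomogeneous (Fintype.card m * k) := by
  have h : ∀ r : σ → K, (linearForm r).IsHomogeneous 1 := fun r =>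
    MvPolynomial.IsHomogeneous.sum _ _ _ fun s _ => by
      rw [MvPolynomial.smul_eq_C_mul]
      simpa using (MvPolynomial.isHomogeneous_C_mul_X (r s) s)
  have := MvPolynomial.IsHomogeneous.prod univ (fun i => linearForm (R i) ^ k) (fun _ => k)
    fun i _ => by simpa using (h (R i)).pow k
  simpa [rowPowProd] using this

end Truncated

open Polynomial in
theorem card_roots_toFinset_of_dvd {F : Type*} [Field F] [Fintype F] [DecidableEq F] {f : F[X]}
    (hf : f ∣ X ^ Fintype.card F - X) : #f.roots.toFinset = f.natDegree := by
  have h0 := FiniteField.X_pow_card_sub_X_ne_zero F (Fintype.one_lt_card (α := F))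
  have hr := FiniteField.roots_X_pow_card_sub_X F
  have hs : (X ^ Fintype.card F - X : F[X]).Splits := by
    rw [splits_iff_card_roots, hr, FiniteField.X_pow_card_sub_X_natDegree_eq F Fintype.one_lt_card]
    rfl
  rw [Multiset.toFinset_card_of_nodup, (hs.of_dvd h0 hf).natDegree_eq_card_roots]
  exact Multiset.nodup_of_le (roots.le_of_dvd h0 hf) (hr ▸ univ.nodup)

open Polynomial in
theorem card_pow_eq_neg {F : Type*} [Field F] [Fintype F] [DecidableEq F] {p : ℕ} [Fact p.Prime]
    [CharP F p] (hF : Fintype.card F = p ^ 2) : #{x : F | x ^ p = -x} = p := by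
  have hp := (Fact.out : p.Prime).one_lt
  have hdeg : (X ^ p + X : F[X]).natDegree = p := by
    rw [natDegree_add_eq_left_of_natDegree_lt (by simpa using hp), natDegree_X_pow]
  have hdvd : (X ^ p + X : F[X]) ∣ X ^ Fintype.card F - X := by
    refine ⟨(X ^ p + X) ^ (p - 1) - 1, ?_⟩
    rw [mul_sub, mul_pow_sub_one (by omega), add_pow_char, hF]
    ring
  have h := card_roots_toFinset_of_dvd hdvd
  rw [hdeg] at h
  convert h using 2
  ext x
  have h0 : (X ^ p + X : F[X]) ≠ 0 := by
    intro h0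
    rw [h0, natDegree_zero] at hdeg
    omega
  simp [mem_roots h0, eq_neg_iff_add_eq_zero]

open Polynomial in
theorem exists_pair_pow_eq_neg_one {F : Type*} [Field F] [Fintype F] {p : ℕ} [Fact p.Prime]
    [CharP F p] (hF : Fintype.card F = p ^ 2) :
    ∃ w w' : F, w ≠ w' ∧ w ^ (p + 1) = -1 ∧ w' ^ (p + 1) = -1 := by
  classical
  have hp := (Fact.out : p.Prime).one_lt
  have hdeg : (X ^ (p + 1) + 1 : F[X]).natDegree = p + 1 := by compute_degree!
  have hdvd : (X ^ (p + 1) + 1 : F[X]) ∣ X ^ Fintype.card F - X := by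
    have h := (sub_dvd_pow_sub_pow (X ^ (p + 1)) (-1 : F[X]) (p - 1)).mul_left X
    have h1 : (-1 : F[X]) ^ (p - 1) = 1 := by
      rcases (Fact.out : p.Prime).eq_two_or_odd' with rfl | hodd
      · have : CharP F[X] 2 := inferInstance
        rw [CharTwo.neg_eq, one_pow]
      · exact (Nat.Odd.sub_odd hodd odd_one).neg_one_pow
    rw [h1, ← pow_mul, mul_sub, mul_one, ← pow_succ', sub_neg_eq_add] at h
    convert h using 3
    rw [hF]
    obtain ⟨q, rfl⟩ := Nat.exists_eq_add_of_lt hp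
    rw [show 1 + q + 1 - 1 = q + 1 by omega]
    ring
  have h := card_roots_toFinset_of_dvd hdvd
  rw [hdeg] at h
  have h0 : (X ^ (p + 1) + 1 : F[X]) ≠ 0 := by
    intro h0
    rw [h0, natDegree_zero] at hdeg
    omega
  obtain ⟨w, hw, w', hw', hne⟩ := Finset.one_lt_card.1 (by rw [h]; omega)
  simp only [Multiset.mem_toFinset, mem_roots h0, IsRoot.def, eval_add, eval_pow, eval_X,
    eval_one] at hw hw'
  exact ⟨w, w', hne, eq_neg_of_add_eq_zero_left hw, eq_neg_of_add_eq_zero_left hw'⟩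

theorem exists_eq_add_single_of_sum_eq_succ {l : Type*} [Fintype l] [DecidableEq l] {N : ℕ}
    (s : l → ℕ) (hs : ∑ i, s i = N + 1) :
    ∃ (i : l) (s' : l → ℕ), s = s' + Pi.single i 1 ∧ ∑ i, s' i = N := by
  obtain ⟨i, _, hi⟩ := Finset.exists_ne_zero_of_sum_ne_zero (by rw [hs]; omega)
  have h : s = (s - Pi.single i 1) + Pi.single i 1 := by
    ext x
    by_cases hx : x = i
    · subst hx
      simp
      omega
    · simp [hx]
  refine ⟨i, _, h, ?_⟩
  rw [h] at hs
  simp only [Pi.add_apply, Finset.sum_add_distrib] at hs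
  simpa using hs

/-- Nonnegative integer matrices with prescribed row and column sums exist. -/
theorem exists_matrix_sum_eq {m n : Type*} [Fintype m] [Fintype n] (N : ℕ) (r : m → ℕ) (c : n → ℕ)
    (hr : ∑ i, r i = N) (hc : ∑ j, c j = N) :
    ∃ M : m → n → ℕ, (∀ i, ∑ j, M i j = r i) ∧ ∀ j, ∑ i, M i j = c j := by
  classical
  induction N generalizing r c with
  | zero =>
    simp only [Finset.sum_eq_zero_iff, mem_univ, true_imp_iff] at hr hc
    exact ⟨0, by simp [hr], by simp [hc]⟩
  | succ N ih =>
    obtain ⟨i, r, rfl, hr'⟩ := exists_eq_add_single_of_sum_eq_succ r hr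
    obtain ⟨j, c, rfl, hc'⟩ := exists_eq_add_single_of_sum_eq_succ c hc
    obtain ⟨M, h1, h2⟩ := ih r c hr' hc'
    refine ⟨fun a b => M a b + (Pi.single i 1 : m → ℕ) a * (Pi.single j 1 : n → ℕ) b, ?_, ?_⟩
    · intro a
      simp [Finset.sum_add_distrib, h1, ← Finset.mul_sum]
    · intro b
      simp [Finset.sum_add_distrib, h2, ← Finset.sum_mul]

theorem eq_zero_of_sum_eq_zero_on_skewHermitian {F : Type*} [Field F] [Fintype F] {p : ℕ}
    [Fact p.Prime] [CharP F p] (hF : Fintype.card F = p ^ 2) {κ : Type*} (S : Finset κ)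
    (m : κ → Fin 3 → Fin 3 → ℕ) (hm : Set.InjOn m S) (hb : ∀ k ∈ S, ∀ i j, m k i j < p)
    (W : κ → F)
    (h : ∀ Z : Matrix (Fin 3) (Fin 3) F, (∀ i j, Z i j + Z j i ^ p = 0) →
      ∑ k ∈ S, W k * ∏ i, ∏ j, Z i j ^ m k i j = 0) {k : κ} (hk : k ∈ S) : W k = 0 := by
  classical
  have hp := (Fact.out : p.Prime).one_lt
  let E : κ → (Fin 3 × Fin 3 →₀ ℕ) := fun k => Finsupp.equivFunOnFinite.symm fun x =>
    if x.1 = x.2 then m k x.1 x.1 else if x.1 < x.2 then m k x.1 x.2 + p * m k x.2 x.1 else 0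
  have hE : ∀ k x, E k x = if x.1 = x.2 then m k x.1 x.1 else
      if x.1 < x.2 then m k x.1 x.2 + p * m k x.2 x.1 else 0 := fun _ _ => rfl
  let sgn : κ → F := fun k => (-1) ^ (m k 1 0 + m k 2 0 + m k 2 1)
  have hEinj : Set.InjOn E S := by
    intro k hk l hl hkl
    apply hm hk hl
    have digits : ∀ i j, i < j → m k i j = m l i j ∧ m k j i = m l j i := by
      intro i j hij
      have := DFunLike.congr_fun hkl (i, j)
      simp only [hE, hij, hij.ne, if_false, if_true] at this
      have h1 := congrArg (· % p) this
      have h2 := congrArg (· / p) this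
      simp only [Nat.add_mul_mod_self_left, Nat.mod_eq_of_lt (hb _ hk _ _),
        Nat.mod_eq_of_lt (hb _ hl _ _)] at h1
      simp only [Nat.add_mul_div_left _ _ (zero_lt_one.trans hp),
        Nat.div_eq_of_lt (hb _ hk _ _), Nat.div_eq_of_lt (hb _ hl _ _), zero_add] at h2
      exact ⟨h1, h2⟩
    ext i j
    rcases lt_trichotomy i j with hij | rfl | hij
    · exact (digits i j hij).1
    · simpa [hE] using DFunLike.congr_fun hkl (i, i)
    · exact (digits j i hij).2
  let Q : MvPolynomial (Fin 3 × Fin 3) F := ∑ k ∈ S, MvPolynomial.monomial (E k) (W k * sgn k)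
  have hQ : Q = 0 := by
    refine MvPolynomial.eq_zero_of_eval_zero_at_prod_finset Q
      (fun x => if x.1 = x.2 then ({x : F | x ^ p = -x} : Finset F) else univ) ?_ ?_
    · rintro ⟨i, j⟩
      refine (MvPolynomial.degreeOf_sum_le _ _ _).trans_lt ?_
      have hcard : 0 < #(if i = j then ({x : F | x ^ p = -x} : Finset F) else univ) := by
        split_ifs
        · rw [card_pow_eq_neg hF]; omega
        · rw [card_univ, hF]; positivity
      rw [Finset.sup_lt_iff (by simpa using hcard)]
      intro k hk
      have hdeg : MvPolynomial.degreeOf (i, j) (MvPolynomial.monomial (E k) (W k * sgn k)) ≤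
          E k (i, j) := by
        by_cases h0 : W k * sgn k = 0
        · simp [h0]
        · rw [MvPolynomial.degreeOf_monomial_eq _ _ h0]
      refine hdeg.trans_lt ?_
      rw [hE]
      dsimp only
      split_ifs with h1 h2
      · rw [card_pow_eq_neg hF]; exact hb k hk i i
      · rw [card_univ, hF]
        have := hb k hk i j
        have := hb k hk j i
        nlinarith
      · rw [card_univ, hF]; positivity
    · intro t ht
      have hd : ∀ i, t (i, i) ^ p = -t (i, i) := fun i => by simpa using ht (i, i)
      have hpp : ∀ x : F, (x ^ p) ^ p = x := fun x => by
        rw [← pow_mul, ← sq, ← hF, FiniteField.pow_card]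
      have hneg : ∀ x : F, (-x) ^ p = -x ^ p := fun x => by
        simpa [frobenius_def] using map_neg (frobenius F p) x
      have := h (fun i j => if i = j then t (i, i) else if i < j then t (i, j) else -t (j, i) ^ p)
        (by
          intro i j
          rcases lt_trichotomy i j with hij | rfl | hij
          · simp [hij, hij.ne, hij.ne', hij.not_gt, hneg, hpp]
          · simp [hd]
          · simp [hij, hij.ne, hij.ne', hij.not_gt])
      rw [← this, map_sum]
      refine Finset.sum_congr rfl fun k _ => ?_
      rw [MvPolynomial.eval_monomial, Finsupp.prod_fintype _ _ (by simp)]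
      simp only [Fintype.prod_prod_type, Fin.prod_univ_three, hE, sgn]
      simp [pow_add, pow_mul, neg_pow (_ ^ p)]
      ring
  have hc := congrArg (MvPolynomial.coeff (E k)) hQ
  rw [MvPolynomial.coeff_sum, Finset.sum_eq_single k, MvPolynomial.coeff_monomial, if_pos rfl,
    MvPolynomial.coeff_zero] at hc
  · exact (mul_eq_zero.1 hc).resolve_right (pow_ne_zero _ (neg_ne_zero.2 one_ne_zero))
  · intro l hl hlk
    rw [MvPolynomial.coeff_monomial, if_neg fun h => hlk (hEinj hl hk h)]
  · exact fun h => absurd hk h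

theorem linearForm_fromCols_one_pow {K : Type*} [Field K] (k : ℕ) (Z : Matrix (Fin 3) (Fin 3) K)
    (i : Fin 3) :
    linearForm (Matrix.fromCols 1 Z i) ^ k =
      ∑ d ∈ piAntidiag (univ : Finset (Option (Fin 3))) k,
        MvPolynomial.monomial (Finsupp.single (Sum.inl i) (d none) +
          ∑ j, Finsupp.single (Sum.inr j) (d (some j)))
          ((Nat.multinomial univ d : K) * ∏ j, Z i j ^ d (some j)) := by
  have h : linearForm (Matrix.fromCols 1 Z i) = ∑ o : Option (Fin 3),
      o.elim (MvPolynomial.X (Sum.inl i)) fun j => Z i j • MvPolynomial.X (Sum.inr j) := by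
    simp [linearForm, Fintype.sum_sum_type, Fintype.sum_option, Matrix.one_apply, ite_smul]
  rw [h, Finset.sum_pow_eq_sum_piAntidiag]
  refine Finset.sum_congr rfl fun d _ => ?_
  rw [← one_mul (_ * ∏ j, Z i j ^ d (some j)), mul_left_comm, ← MvPolynomial.C_mul_monomial,
    ← MvPolynomial.monomial_mul, MvPolynomial.monomial_sum_prod, Fintype.prod_option]
  simp [_root_.smul_pow, MvPolynomial.X_pow_eq_monomial, MvPolynomial.smul_monomial]

theorem coeff_rowPowProd_fromCols_one {K : Type*} [Field K] (k : ℕ)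
    (Z : Matrix (Fin 3) (Fin 3) K) (β : Fin 3 ⊕ Fin 3 →₀ ℕ) :
    (rowPowProd k (Matrix.fromCols 1 Z)).coeff β =
      ∑ d ∈ Fintype.piFinset fun _ : Fin 3 => piAntidiag (univ : Finset (Option (Fin 3))) k,
        if ∑ i, (Finsupp.single (Sum.inl i) (d i none) +
          ∑ j, Finsupp.single (Sum.inr j) (d i (some j))) = β then
          (∏ i, (Nat.multinomial univ (d i) : K)) * ∏ i, ∏ j, Z i j ^ d i (some j) else 0 := by
  simp only [rowPowProd, linearForm_fromCols_one_pow, Finset.prod_univ_sum,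
    ← MvPolynomial.monomial_sum_prod, MvPolynomial.coeff_sum, MvPolynomial.coeff_monomial,
    Finset.prod_mul_distrib]

theorem Nat.Prime.not_dvd_multinomial {p : ℕ} (hp : p.Prime) {α : Type*} (s : Finset α)
    (f : α → ℕ) (h : ∑ i ∈ s, f i < p) : ¬ p ∣ Nat.multinomial s f := by
  intro hd
  have := (hd.mul_left (∏ i ∈ s, (f i).factorial))
  rw [Nat.multinomial_spec, hp.dvd_factorial] at this
  omega

theorem eq_zero_of_sum_mul_coeff_eq_zero {F : Type*} [Field F] [Fintype F] {p : ℕ}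
    [Fact p.Prime] [CharP F p] (hF : Fintype.card F = p ^ 2) (c : (Fin 3 ⊕ Fin 3 →₀ ℕ) → F)
    (h : ∀ Z : Matrix (Fin 3) (Fin 3) F, (∀ i j, Z i j + Z j i ^ p = 0) →
      ∑ β ∈ truncatedExponents p,
        c β * (rowPowProd (p - 1) (Matrix.fromCols 1 Z)).coeff β = 0)
    {β : Fin 3 ⊕ Fin 3 →₀ ℕ} (hβ : β ∈ truncatedExponents p) : c β = 0 := by
  have hp := (Fact.out : p.Prime)
  have hp1 := hp.one_lt
  let S := Fintype.piFinset fun _ : Fin 3 => piAntidiag (univ : Finset (Option (Fin 3))) (p - 1)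
  let b : (Fin 3 → Option (Fin 3) → ℕ) → (Fin 3 ⊕ Fin 3 →₀ ℕ) := fun d =>
    ∑ i, (Finsupp.single (Sum.inl i) (d i none) + ∑ j, Finsupp.single (Sum.inr j) (d i (some j)))
  have hS : ∀ d, d ∈ S ↔ ∀ i, d i none + ∑ j, d i (some j) = p - 1 := by
    intro d
    simp [S, Fintype.sum_option]
  have hbl : ∀ d i, b d (Sum.inl i) = d i none := by
    intro d i
    simp [b, Finsupp.finsetSum_apply, Finsupp.single_apply]
  have hbr : ∀ d j, b d (Sum.inr j) = ∑ i, d i (some j) := by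
    intro d j
    simp [b, Finsupp.finsetSum_apply, Finsupp.single_apply]
  have key := fun (d) (hd : d ∈ S) => eq_zero_of_sum_eq_zero_on_skewHermitian hF S
    (fun d i j => d i (some j)) (by
      intro d hd d' hd' hdd
      have hdd : ∀ i j, d i (some j) = d' i (some j) := fun i j => congrFun (congrFun hdd i) j
      ext i (_ | j)
      · have h1 := (hS d).1 hd i
        have h2 := (hS d').1 hd' i
        simp only [hdd] at h1
        omega
      · exact hdd i j) (by
      intro d hd i j
      have h1 := (hS d).1 hd i
      have h2 := Finset.single_le_sum (f := fun j => d i (some j)) (fun _ _ => Nat.zero_le _)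
        (mem_univ j)
      exact (show d i (some j) ≤ p - 1 by omega).trans_lt (by omega))
    (fun d => if b d ∈ truncatedExponents p then
      c (b d) * ∏ i, (Nat.multinomial univ (d i) : F) else 0) (by
      intro Z hZ
      refine Eq.trans ?_ (h Z hZ)
      simp only [coeff_rowPowProd_fromCols_one, Finset.mul_sum]
      rw [Finset.sum_comm]
      refine Finset.sum_congr rfl fun d _ => ?_
      simp only [mul_ite, mul_zero]
      rw [Finset.sum_ite_eq]
      simp only [ite_mul, zero_mul, mul_assoc]
      rfl) hd
  obtain ⟨hsum, hlt⟩ := mem_truncatedExponents.1 hβ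
  rw [Fintype.sum_sum_type] at hsum
  obtain ⟨M, hr, hc⟩ := exists_matrix_sum_eq (∑ j, β (Sum.inr j))
    (fun i => p - 1 - β (Sum.inl i)) (fun j => β (Sum.inr j)) (by
      have : ∑ i : Fin 3, (p - 1 - β (Sum.inl i)) + ∑ i : Fin 3, β (Sum.inl i) = 3 * (p - 1) := by
        rw [← Finset.sum_add_distrib, Finset.sum_congr rfl fun i _ =>
          Nat.sub_add_cancel (Nat.le_sub_one_of_lt (hlt (Sum.inl i)))]
        simp
      omega) rfl
  let d : Fin 3 → Option (Fin 3) → ℕ := fun i o => o.elim (β (Sum.inl i)) (M i)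
  have hd : d ∈ S := (hS d).2 fun i => by
    have := hlt (Sum.inl i)
    simp only [d, Option.elim, hr]
    omega
  have hbd : b d = β := by
    ext (i | j)
    · rw [hbl]; rfl
    · rw [hbr]; exact hc j
  have hk := key d hd
  simp only [hbd, if_pos hβ] at hk
  refine (mul_eq_zero.1 hk).resolve_right (Finset.prod_ne_zero_iff.2 fun i _ => ?_)
  rw [Ne, CharP.cast_eq_zero_iff F p]
  refine hp.not_dvd_multinomial _ _ ?_
  have := (hS d).1 hd i
  rw [Fintype.sum_option]
  omega

/-- The matrix whose `j`-th column gives the hyperbolic Hermitian form with the `j`-th row of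
`X` in the second argument. -/
def hermitianDual {K m n : Type*} [Field K] (p : ℕ) (X : Matrix m (n ⊕ n) K) :
    Matrix (n ⊕ n) m K :=
  Matrix.of fun s i => X i s.swap ^ p

theorem mul_hermitianDual_apply {K m m' n : Type*} [Field K] [Fintype n] (p : ℕ)
    (X : Matrix m (n ⊕ n) K) (Y : Matrix m' (n ⊕ n) K) (i : m) (j : m') :
    (X * hermitianDual p Y) i j =
      ∑ k, (X i (Sum.inl k) * Y j (Sum.inr k) ^ p + X i (Sum.inr k) * Y j (Sum.inl k) ^ p) := by
  simp [hermitianDual, Matrix.mul_apply, Fintype.sum_sum_type, Finset.sum_add_distrib]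

theorem exists_det_fromCols_hermitianDual {K n : Type*} [Field K] (p : ℕ) [Fact p.Prime]
    [CharP K p] [Fintype n] [DecidableEq n] : ∃ j : K, j ≠ 0 ∧ ∀ X Y : Matrix n (n ⊕ n) K,
      (Matrix.fromCols (hermitianDual p X) (hermitianDual p Y)).det =
        j * (Matrix.fromRows X Y).det ^ p := by
  refine ⟨((Equiv.Perm.sign (Equiv.sumComm n n) : ℤ) : K), ?_, fun X Y => ?_⟩
  · rcases Int.units_eq_one_or (Equiv.Perm.sign (Equiv.sumComm n n)) with h | h <;> simp [h]
  · have h : Matrix.fromCols (hermitianDual p X) (hermitianDual p Y) =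
        (((Matrix.fromRows X Y).map (frobenius K p)).submatrix id
          (Equiv.sumComm n n)).transpose := by
      ext s (i | i) <;> simp [hermitianDual, frobenius_def]
    have h2 := RingHom.map_det (frobenius K p) (Matrix.fromRows X Y)
    rw [h, Matrix.det_transpose, Matrix.det_permute', ← frobenius_def p, h2]
    rfl

theorem det_fromRows_mul_det_fromCols {K m : Type*} [Field K] [Fintype m] [DecidableEq m]
    (c a : Matrix m (m ⊕ m) K) (x y : Matrix (m ⊕ m) m K) (h : a * x = 0) :
    (Matrix.fromRows c a).det * (Matrix.fromCols x y).det = (c * x).det * (a * y).det := by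
  rw [← Matrix.det_mul, Matrix.fromRows_mul_fromCols, h, Matrix.det_fromBlocks_zero₂₁]

/-- On pairs of opposite maximal isotropic subspaces, the `(p - 1)`-st power of the determinant
splits as a product of a function of each subspace. -/
theorem exists_det_fromRows_pow_eq_mul {K n G : Type*} [Field K] (p : ℕ) [Fact p.Prime]
    [CharP K p] [Fintype n] [DecidableEq n] (R C : G → Matrix n (n ⊕ n) K)
    (hR : ∀ a, R a * hermitianDual p (R a) = 0)
    (hC : ∀ a, (Matrix.fromRows (C a) (R a)).det ≠ 0)
    (hC' : ∀ a, (Matrix.fromRows (R a) (C a)).det ≠ 0) :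
    ∃ l r : G → K, (∀ a, l a ≠ 0) ∧ (∀ b, r b ≠ 0) ∧ ∀ a b,
      (Matrix.fromRows (R a) (R b)).det ≠ 0 →
        (Matrix.fromRows (R a) (R b)).det ^ (p - 1) = l a * r b := by
  obtain ⟨j, hj, hdet⟩ := exists_det_fromCols_hermitianDual (K := K) (n := n) p
  have hsplit : ∀ a (X Y : Matrix n (n ⊕ n) K), (Matrix.fromRows X (R a)).det *
      (j * (Matrix.fromRows (R a) Y).det ^ p) =
        (X * hermitianDual p (R a)).det * (R a * hermitianDual p Y).det := fun a X Y => by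
    rw [← hdet (R a) Y, det_fromRows_mul_det_fromCols X (R a) _ _ (hR a)]
  have hne : ∀ a, (C a * hermitianDual p (R a)).det * (R a * hermitianDual p (C a)).det ≠ 0 :=
    fun a => by
      rw [← hsplit]
      exact mul_ne_zero (hC a) (mul_ne_zero hj (pow_ne_zero _ (hC' a)))
  refine ⟨fun a => (C a * hermitianDual p (R a)).det / (Matrix.fromRows (C a) (R a)).det,
    fun b => (Matrix.fromRows (R b) (C b)).det ^ p / (R b * hermitianDual p (C b)).det,
    fun a => div_ne_zero (left_ne_zero_of_mul (hne a)) (hC a),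
    fun b => div_ne_zero (pow_ne_zero _ (hC' b)) (right_ne_zero_of_mul (hne b)), fun a b hab => ?_⟩
  have h1 := hsplit a (C a) (R b)
  have h2 := hsplit b (R a) (C b)
  rw [div_mul_div_comm, eq_div_iff (mul_ne_zero (hC a) (right_ne_zero_of_mul (hne b)))]
  refine mul_left_cancel₀ (mul_ne_zero hj hab) ?_
  have hp : (Matrix.fromRows (R a) (R b)).det ^ p =
      (Matrix.fromRows (R a) (R b)).det ^ (p - 1) * (Matrix.fromRows (R a) (R b)).det := by
    rw [← pow_succ, Nat.sub_add_cancel (Fact.out : p.Prime).one_le]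
  rw [hp] at h1
  linear_combination (R b * hermitianDual p (C b)).det * h1 -
    (C a * hermitianDual p (R a)).det * h2

theorem exists_det_fromRows_ne_zero {K n : Type*} [Field K] [Fintype n] [DecidableEq n]
    (R : Matrix n (n ⊕ n) K) (hR : LinearIndependent K R.row) :
    ∃ C : Matrix n (n ⊕ n) K, (Matrix.fromRows C R).det ≠ 0 ∧ (Matrix.fromRows R C).det ≠ 0 := by
  obtain ⟨Q, hQ⟩ := (Submodule.span K (Set.range R.row)).exists_isCompl
  have hd : Module.finrank K Q = Fintype.card n := by
    have h1 := Submodule.finrank_add_eq_of_isCompl hQ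
    rw [finrank_span_eq_card hR] at h1
    simpa using h1
  let b := (Module.finBasisOfFinrankEq K Q hd).reindex (Fintype.equivFin n).symm
  have hb : LinearIndependent K fun i => (b i : n ⊕ n → K) :=
    b.linearIndependent.map' Q.subtype Q.ker_subtype
  have hdis : Disjoint (Submodule.span K (Set.range R.row))
      (Submodule.span K (Set.range fun i => (b i : n ⊕ n → K))) :=
    hQ.disjoint.mono_right (Submodule.span_le.2 (by rintro _ ⟨i, rfl⟩; exact (b i).2))
  refine ⟨Matrix.of fun i => (b i : n ⊕ n → K), ?_, ?_⟩
  · rw [← isUnit_iff_ne_zero, ← Matrix.isUnit_iff_isUnit_det,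
      ← Matrix.linearIndependent_rows_iff_isUnit]
    exact hb.sum_type hR hdis.symm
  · rw [← isUnit_iff_ne_zero, ← Matrix.isUnit_iff_isUnit_det,
      ← Matrix.linearIndependent_rows_iff_isUnit]
    exact hR.sum_type hb hdis

theorem rank_det_fromRows_pow {F G : Type*} [Field F] [Fintype F] [Fintype G] {p : ℕ}
    [Fact p.Prime] [CharP F p] (hF : Fintype.card F = p ^ 2)
    (R : G → Matrix (Fin 3) (Fin 3 ⊕ Fin 3) F)
    (hR : ∀ Z : Matrix (Fin 3) (Fin 3) F, (∀ i j, Z i j + Z j i ^ p = 0) →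
      ∃ a, ∃ C : Matrix (Fin 3) (Fin 3) F, Matrix.fromCols 1 Z = C * R a) :
    (Matrix.of fun a b => (Matrix.fromRows (R a) (R b)).det ^ (p - 1)).rank =
      #(truncatedExponents p) := by
  classical
  have hp := (Fact.out : p.Prime).one_lt
  let top : Fin 3 ⊕ Fin 3 →₀ ℕ := Finsupp.equivFunOnFinite.symm fun _ => p - 1
  have htop : ∀ s, top s = p - 1 := fun _ => rfl
  have hle : ∀ {β}, β ∈ truncatedExponents p → β ≤ top := fun {β} hβ s =>
    Nat.le_sub_one_of_lt ((mem_truncatedExponents.1 hβ).2 s)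
  have hcompl : ∀ {β}, β ∈ truncatedExponents p → top - β ∈ truncatedExponents p := by
    intro β hβ
    obtain ⟨h1, h2⟩ := mem_truncatedExponents.1 hβ
    refine mem_truncatedExponents.2 ⟨?_, fun s => ?_⟩
    · have h3 : ∑ s, (top - β) s + ∑ s, β s = ∑ s, top s := by
        rw [← Finset.sum_add_distrib]
        exact Finset.sum_congr rfl fun s _ => Nat.sub_add_cancel (hle hβ s)
      simp only [htop, sum_const, card_univ, Fintype.card_sum, Fintype.card_fin, smul_eq_mul,
        h1] at h3
      omega
    · rw [Finsupp.tsub_apply, htop]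
      omega
  have hinv : ∀ {β}, β ∈ truncatedExponents p → top - (top - β) = β := fun hβ =>
    tsub_tsub_cancel_of_le (hle hβ)
  let Φ : Matrix G (truncatedExponents p) F := Matrix.of fun a β =>
    (rowPowProd (p - 1) (R a)).coeff β.1
  let Ψ : Matrix (truncatedExponents p) G F := Matrix.of fun β b =>
    (rowPowProd (p - 1) (R b)).coeff (top - β.1)
  have hindep : ∀ c : (Fin 3 ⊕ Fin 3 →₀ ℕ) → F, (∀ a, ∑ β ∈ truncatedExponents p,
      c β * (rowPowProd (p - 1) (R a)).coeff β = 0) → ∀ β ∈ truncatedExponents p, c β = 0 := by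
    intro c hc β hβ
    refine eq_zero_of_sum_mul_coeff_eq_zero hF c (fun Z hZ => ?_) hβ
    obtain ⟨a, C, hC⟩ := hR Z hZ
    rw [hC, ← mul_zero (C.det ^ (p - 1)), ← hc a, Finset.mul_sum]
    refine Finset.sum_congr rfl fun β hβ => ?_
    rw [coeff_rowPowProd_mul _ _ (mem_truncatedExponents.1 hβ).2, mul_left_comm]
  have hΦ : LinearIndependent F Φ.col := by
    rw [Fintype.linearIndependent_iff]
    intro g hg β
    have := hindep (fun β => if h : β ∈ truncatedExponents p then g ⟨β, h⟩ else 0) (fun a => by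
      rw [← Finset.sum_coe_sort]
      simpa [Φ] using congrFun hg a) β.1 β.2
    simpa using this
  have hΨ : LinearIndependent F Ψ.row := by
    rw [Fintype.linearIndependent_iff]
    intro g hg β
    have := hindep (fun β => if h : top - β ∈ truncatedExponents p then g ⟨top - β, h⟩ else 0)
      (fun a => by
        refine Eq.trans ?_ (congrFun hg a)
        rw [Finset.sum_apply, ← Finset.sum_coe_sort]
        refine Finset.sum_nbij' (fun β => ⟨top - β.1, hcompl β.2⟩)
          (fun β => ⟨top - β.1, hcompl β.2⟩) (by simp) (by simp) ?_ ?_ ?_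
        · exact fun β _ => Subtype.ext (hinv β.2)
        · exact fun β _ => Subtype.ext (hinv β.2)
        · intro β _
          simp [Ψ, hcompl β.2, hinv β.2]) (top - β.1) (hcompl β.2)
    simpa [hinv β.2] using this
  rw [show (Matrix.of fun a b => (Matrix.fromRows (R a) (R b)).det ^ (p - 1)) = Φ * Ψ from ?_,
    Matrix.rank_mul_eq_card_of_linearIndependent _ _ hΦ hΨ, Fintype.card_coe]
  ext a b
  rw [Matrix.of_apply, ← coeff_rowPowProd_square, rowPowProd_fromRows, MvPolynomial.coeff_mul,
    Matrix.mul_apply]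
  refine Eq.symm (Eq.trans (Finset.sum_coe_sort (truncatedExponents p) fun β =>
    (rowPowProd (p - 1) (R a)).coeff β * (rowPowProd (p - 1) (R b)).coeff (top - β)) ?_)
  refine Finset.sum_of_injOn (fun β => (β, top - β)) (fun _ _ _ _ h => (Prod.ext_iff.1 h).1)
    (fun β hβ => by simpa using add_tsub_cancel_of_le (hle hβ)) ?_ fun _ _ => rfl
  rintro ⟨β, γ⟩ h hn
  rw [HasAntidiagonal.mem_antidiagonal] at h
  by_contra hne
  refine hn ⟨β, mem_truncatedExponents.2 ⟨?_, fun s => ?_⟩, Prod.ext rfl ?_⟩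
  · have := isHomogeneous_rowPowProd (p - 1) (R a) (left_ne_zero_of_mul hne)
    rw [Finsupp.weight_apply, Finsupp.sum_fintype _ _ (by simp)] at this
    simpa using this
  · have := DFunLike.congr_fun h s
    simp only [Finsupp.add_apply] at this
    have h2 : top s = p - 1 := rfl
    have h3 : β s + γ s = p - 1 := this
    omega
  · change top - β = γ
    rw [← (show β + γ = top from h), add_tsub_cancel_left]

theorem exists_hyperbolic_coordinates {F : Type*} [Field F] [Fintype F] {p : ℕ}
    [Fact p.Prime] [CharP F p] (hF : Fintype.card F = p ^ 2) :
    ∃ T : (Fin 3 ⊕ Fin 3 → F) ≃ₗ[F] (Fin 6 → F), ∀ x y, ∑ i, T x i * T y i ^ p =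
      ∑ k, (x (Sum.inl k) * y (Sum.inr k) ^ p + x (Sum.inr k) * y (Sum.inl k) ^ p) := by
  have hp := (Fact.out : p.Prime)
  obtain ⟨w, w', hne, hw, hw'⟩ := exists_pair_pow_eq_neg_one hF
  have hw0 : w' ≠ 0 := by
    rintro rfl
    simp at hw'
  have hpp : ∀ x : F, (x ^ p) ^ p = x := fun x => by
    rw [← pow_mul, ← sq, ← hF, FiniteField.pow_card]
  have hκ : 1 + w * w' ^ p ≠ 0 := by
    intro h
    rw [pow_succ'] at hw'
    refine hne (mul_right_cancel₀ (pow_ne_zero p hw0) ?_)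
    linear_combination h - hw'
  let s := ((1 + w * w' ^ p) ^ p)⁻¹
  have hs1 : s * (1 + w * w' ^ p) ^ p = 1 := inv_mul_cancel₀ (pow_ne_zero _ hκ)
  have hs2 : s ^ p * (1 + w * w' ^ p) = 1 := by
    rw [inv_pow, hpp, inv_mul_cancel₀ hκ]
  rw [add_pow_char, one_pow, mul_pow, hpp] at hs1
  rw [pow_succ] at hw hw'
  let L : (Fin 3 ⊕ Fin 3 → F) →ₗ[F] (Fin 6 → F) :=
    { toFun := fun x i => Sum.elim (fun k => x (Sum.inl k) + s * x (Sum.inr k))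
        (fun k => w * x (Sum.inl k) + s * w' * x (Sum.inr k))
        ((finSumFinEquiv (m := 3) (n := 3)).symm i)
      map_add' := fun x y => by
        ext i
        rcases h : (finSumFinEquiv (m := 3) (n := 3)).symm i with k | k <;> simp [h] <;> ring
      map_smul' := fun c x => by
        ext i
        rcases h : (finSumFinEquiv (m := 3) (n := 3)).symm i with k | k <;> simp [h] <;> ring }
  have hL : ∀ x y, ∑ i, L x i * L y i ^ p =
      ∑ k, (x (Sum.inl k) * y (Sum.inr k) ^ p + x (Sum.inr k) * y (Sum.inl k) ^ p) := by
    intro x y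
    rw [← (finSumFinEquiv (m := 3) (n := 3)).sum_comp, Fintype.sum_sum_type,
      ← Finset.sum_add_distrib]
    refine Finset.sum_congr rfl fun k _ => ?_
    simp only [L, LinearMap.coe_mk, AddHom.coe_mk, Equiv.symm_apply_apply, Sum.elim_inl,
      Sum.elim_inr, add_pow_char, mul_pow]
    linear_combination x (Sum.inl k) * y (Sum.inl k) ^ p * hw +
      x (Sum.inl k) * y (Sum.inr k) ^ p * hs2 + x (Sum.inr k) * y (Sum.inl k) ^ p * hs1 +
      s * s ^ p * x (Sum.inr k) * y (Sum.inr k) ^ p * hw'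
  have hinj : Function.Injective L := by
    rw [← LinearMap.ker_eq_bot, LinearMap.ker_eq_bot']
    intro x hx
    have h : ∀ y : Fin 3 ⊕ Fin 3 → F, ∑ k, (x (Sum.inl k) * y (Sum.inr k) ^ p +
        x (Sum.inr k) * y (Sum.inl k) ^ p) = 0 := fun y => by
      rw [← hL, hx]
      simp
    ext (k | k)
    · simpa [Pi.single_apply, ite_pow, hp.ne_zero] using h (Pi.single (Sum.inr k) 1)
    · simpa [Pi.single_apply, ite_pow, hp.ne_zero] using h (Pi.single (Sum.inl k) 1)
  exact ⟨L.linearEquivOfInjective hinj (by simp), fun x y => hL x y⟩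

theorem det_fromRows_ne_zero_iff_disjoint {K n : Type*} [Field K] [Fintype n] [DecidableEq n]
    {X Y : Matrix n (n ⊕ n) K} (hX : LinearIndependent K X.row) (hY : LinearIndependent K Y.row) :
    (Matrix.fromRows X Y).det ≠ 0 ↔
      Disjoint (Submodule.span K (Set.range X.row)) (Submodule.span K (Set.range Y.row)) := by
  rw [← isUnit_iff_ne_zero, ← Matrix.isUnit_iff_isUnit_det,
    ← Matrix.linearIndependent_rows_iff_isUnit]
  exact linearIndependent_sum.trans ⟨fun h => h.2.2, fun h => ⟨hX, hY, h⟩⟩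

theorem exists_generator_matrices {F : Type*} [Field F] [Fintype F] {p : ℕ}
    [Fact p.Prime] [CharP F p] (hF : Fintype.card F = p ^ 2) {G : Type*}
    (e : G ≃ {W : Submodule F (Fin 6 → F) // Module.finrank F W = 3 ∧
      ∀ x ∈ W, ∀ y ∈ W, ∑ i, x i * y i ^ p = 0}) :
    ∃ R : G → Matrix (Fin 3) (Fin 3 ⊕ Fin 3) F,
      (∀ a, LinearIndependent F (R a).row) ∧
      (∀ a, R a * hermitianDual p (R a) = 0) ∧
      (∀ a b, (e a).1 ⊓ (e b).1 = ⊥ ↔ (Matrix.fromRows (R a) (R b)).det ≠ 0) ∧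
      ∀ Z : Matrix (Fin 3) (Fin 3) F, (∀ i j, Z i j + Z j i ^ p = 0) →
        ∃ a, ∃ C : Matrix (Fin 3) (Fin 3) F, Matrix.fromCols 1 Z = C * R a := by
  obtain ⟨T, hT⟩ := exists_hyperbolic_coordinates hF
  let b : ∀ a, Module.Basis (Fin 3) F (e a).1 := fun a =>
    Module.finBasisOfFinrankEq F (e a).1 (e a).2.1
  let R : G → Matrix (Fin 3) (Fin 3 ⊕ Fin 3) F := fun a =>
    Matrix.of fun i => T.symm (b a i : Fin 6 → F)
  have hTR : ∀ a i, T (R a i) = b a i := fun a i => T.apply_symm_apply _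
  have hli : ∀ a, LinearIndependent F (R a).row := fun a =>
    ((b a).linearIndependent.map' (e a).1.subtype (e a).1.ker_subtype).map' T.symm.toLinearMap
      T.symm.ker
  have hspan : ∀ a, Submodule.span F (Set.range (R a).row) = (e a).1.comap T.toLinearMap := by
    intro a
    refine Submodule.eq_of_le_of_finrank_eq (Submodule.span_le.2 ?_) ?_
    · rintro _ ⟨i, rfl⟩
      change T (R a i) ∈ (e a).1
      rw [hTR]
      exact (b a i).2
    · rw [finrank_span_eq_card (hli a), Fintype.card_fin]
      refine (e a).2.1.symm.trans ((T.submoduleMap _).finrank_eq.trans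
        (by rw [Submodule.map_comap_eq_of_surjective T.surjective])).symm
  refine ⟨R, hli, fun a => ?_, fun a c => ?_, fun Z hZ => ?_⟩
  · ext i j
    rw [mul_hermitianDual_apply, ← hT, hTR, hTR]
    exact (e a).2.2 _ (b a i).2 _ (b a j).2
  · rw [det_fromRows_ne_zero_iff_disjoint (hli a) (hli c), hspan, hspan, disjoint_iff,
      ← Submodule.comap_inf]
    refine ⟨fun h => by rw [h]; exact LinearMap.ker_eq_bot.2 T.injective, fun h => ?_⟩
    exact Submodule.comap_injective_of_surjective T.surjective
      (h.trans (LinearMap.ker_eq_bot.2 T.injective).symm)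
  · let X : Matrix (Fin 3) (Fin 3 ⊕ Fin 3) F := Matrix.fromCols 1 Z
    have hrow : LinearIndependent F X.row := by
      rw [Fintype.linearIndependent_iff]
      intro g hg i
      simpa [X, Matrix.one_apply] using congrFun hg (Sum.inl i)
    let W := (Submodule.span F (Set.range X.row)).map T.toLinearMap
    have hW : Module.finrank F W = 3 := by
      rw [LinearEquiv.finrank_map_eq, finrank_span_eq_card hrow, Fintype.card_fin]
    have hiso : ∀ x ∈ W, ∀ y ∈ W, ∑ i, x i * y i ^ p = 0 := by
      rintro _ ⟨x, hx, rfl⟩ _ ⟨y, hy, rfl⟩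
      obtain ⟨c, rfl⟩ := Submodule.mem_span_range_iff_exists_fun F |>.1 hx
      obtain ⟨d, rfl⟩ := Submodule.mem_span_range_iff_exists_fun F |>.1 hy
      refine (hT _ _).trans ?_
      have h1 : ∀ i k, (1 : Matrix (Fin 3) (Fin 3) F) i k = if i = k then 1 else 0 :=
        fun i k => Matrix.one_apply
      simp only [X, Finset.sum_apply, Pi.smul_apply, Matrix.row_apply, Matrix.fromCols_apply_inl,
        Matrix.fromCols_apply_inr, smul_eq_mul, h1, mul_ite, mul_one, mul_zero,
        Finset.sum_ite_eq', Finset.mem_univ, if_true]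
      simp only [sum_pow_char, mul_pow, Finset.sum_add_distrib, Finset.mul_sum, Finset.sum_mul]
      rw [add_comm, Finset.sum_comm, ← Finset.sum_add_distrib]
      refine Finset.sum_eq_zero fun i _ => ?_
      rw [← Finset.sum_add_distrib]
      refine Finset.sum_eq_zero fun j _ => ?_
      linear_combination c i * d j ^ p * hZ i j
    obtain ⟨a, ha⟩ := e.surjective ⟨W, hW, hiso⟩
    have hmem : ∀ i, X i ∈ Submodule.span F (Set.range (R a).row) := by
      intro i
      rw [hspan, ha]
      exact ⟨_, Submodule.subset_span ⟨i, rfl⟩, rfl⟩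
    choose C hC using fun i => Submodule.mem_span_range_iff_exists_fun F |>.1 (hmem i)
    refine ⟨a, Matrix.of C, ?_⟩
    ext i s
    simpa [Matrix.mul_apply] using (congrFun (hC i) s).symm

theorem Matrix.rank_diagonal_mul_mul_diagonal {K n : Type*} [Field K] [Fintype n] [DecidableEq n]
    (l r : n → K) (hl : ∀ i, l i ≠ 0) (hr : ∀ i, r i ≠ 0) (M : Matrix n n K) :
    (Matrix.diagonal l * M * Matrix.diagonal r).rank = M.rank := by
  rw [Matrix.rank_mul_eq_left_of_isUnit_det, Matrix.rank_mul_eq_right_of_isUnit_det]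
  · simpa [Matrix.det_diagonal, Finset.prod_eq_zero_iff] using hl
  · simpa [Matrix.det_diagonal, Finset.prod_eq_zero_iff] using hr

end Auxiliary

/-- The `p`-rank of the oppositeness matrix of generators of `H(5, p²)` is
`(11p⁵ + 5p³ + 4p)/20`. -/
theorem prank_oppositeness_H5 (p : ℕ) (hp : p.Prime)
    (F : Type) [Field F] [Fintype F] (hF : Fintype.card F = p ^ 2)
    (G : Type) [Fintype G]
    (e : G ≃ {W : Submodule F (Fin 6 → F) // Module.finrank F W = 3 ∧
      ∀ x ∈ W, ∀ y ∈ W, ∑ i, x i * y i ^ p = 0})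
    (A : Matrix G G (ZMod p))
    (hA1 : ∀ a b : G, (e a).1 ⊓ (e b).1 = ⊥ → A a b = 1)
    (hA0 : ∀ a b : G, (e a).1 ⊓ (e b).1 ≠ ⊥ → A a b = 0) :
    A.rank = (11 * p ^ 5 + 5 * p ^ 3 + 4 * p) / 20 := by
  classical
  have : Fact p.Prime := ⟨hp⟩
  have : CharP F p := charP_of_card_eq_prime_pow hF
  obtain ⟨R, hli, hiso, hdis, hZ⟩ := exists_generator_matrices hF e
  choose C hC hC' using fun a => exists_det_fromRows_ne_zero (R a) (hli a)
  obtain ⟨l, r, hl, hr, hlr⟩ := exists_det_fromRows_pow_eq_mul p R C hiso hC hC'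
  have hM : Matrix.of (fun a b => (Matrix.fromRows (R a) (R b)).det ^ (p - 1)) =
      Matrix.diagonal l * A.map (ZMod.castHom dvd_rfl F) * Matrix.diagonal r := by
    ext a b
    rw [Matrix.mul_diagonal, Matrix.diagonal_mul, Matrix.of_apply, Matrix.map_apply]
    by_cases h : (e a).1 ⊓ (e b).1 = ⊥
    · rw [hlr a b ((hdis a b).1 h), hA1 a b h, map_one, mul_one]
    · rw [hA0 a b h, map_zero, mul_zero, zero_mul, not_ne_iff.1 fun h' => h ((hdis a b).2 h'),
        zero_pow (Nat.sub_ne_zero_of_lt hp.one_lt)]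
  have hrank := rank_det_fromRows_pow hF R hZ
  rw [hM, Matrix.rank_diagonal_mul_mul_diagonal l r hl hr, Matrix.rank_map_of_fieldHom] at hrank
  have := card_truncatedExponents hp.two_le
  omega
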